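/- Let n ≥ 2 and let S ⊆ M_n(ℂ) be an irreducible multiplicative semigroup with closure of ℝ₊S equal to S, such that each member of S is diagonally similar to a matrix with all entries nonnegative real. Then there exists an invertible diagonal matrix D ∈ M_n(ℂ) such that: (i) every matrix in D S D⁻¹ has real entries; (ii) there exist subsets X, Y ⊆ ℝ₊^n, each spanning ℂ^n, with D S₁ D⁻¹ = { x yᵀ : x ∈ X, y ∈ Y }, where S₁ is the set of members of S of rank at most one; and (iii) the convex cone of ℝ₊^n generated by X is a proper cone invariant under every member of D S D⁻¹. -/

import Mathlib

open Matrix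

/-- A complex matrix is diagonally similar to a matrix with all entries nonnegative real if
some invertible diagonal conjugation takes it to such a matrix. -/
def DiagSimNonneg {n : ℕ} (A : Matrix (Fin n) (Fin n) ℂ) : Prop :=
  ∃ d : Fin n → ℂ, (∀ i, d i ≠ 0) ∧
    ∀ i j, 0 ≤ ((diagonal d * A * diagonal (fun i => (d i)⁻¹)) i j).re ∧
      ((diagonal d * A * diagonal (fun i => (d i)⁻¹)) i j).im = 0

/-- The convex cone generated by a set `X ⊆ ℝⁿ`: all finite nonnegative combinations of
elements of `X`. -/
def coneGen {n : ℕ} (X : Set (Fin n → ℝ)) : Set (Fin n → ℝ) :=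
  {v | ∃ (m : ℕ) (c : Fin m → ℝ) (x : Fin m → Fin n → ℝ),
    (∀ i, 0 ≤ c i) ∧ (∀ i, x i ∈ X) ∧ v = ∑ i, c i • x i}

/-- A proper cone in `ℝⁿ`: a closed convex cone that is pointed (`K ∩ (−K) = {0}`) and solid
(nonempty interior). -/
def IsProperCone {n : ℕ} (K : Set (Fin n → ℝ)) : Prop :=
  (0 : Fin n → ℝ) ∈ K ∧ (∀ x ∈ K, ∀ y ∈ K, x + y ∈ K) ∧
  (∀ r : ℝ, 0 ≤ r → ∀ x ∈ K, r • x ∈ K) ∧ IsClosed K ∧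
  (∀ x ∈ K, -x ∈ K → x = 0) ∧ (interior K).Nonempty

section

open scoped ComplexOrder

/-- In a finite-dimensional space the convex hull of a compact set is compact. -/
theorem isCompact_convexHull_of_isCompact {E : Type*} [AddCommGroup E] [Module ℝ E]
    [FiniteDimensional ℝ E] [TopologicalSpace E] [ContinuousAdd E] [ContinuousSMul ℝ E]
    {s : Set E} (hs : IsCompact s) : IsCompact (convexHull ℝ s) := by
  let N := Module.finrank ℝ E + 1
  let f : (Fin N → ℝ) × (Fin N → E) → E := fun p => ∑ i, p.1 i • p.2 i
  have hf : Continuous f := by fun_prop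
  have himg : convexHull ℝ s = f '' (stdSimplex ℝ (Fin N) ×ˢ Set.univ.pi fun _ => s) := by
    apply Set.Subset.antisymm
    · intro x hx
      obtain ⟨ι, _, z, w, hz, hind, hw, hw1, rfl⟩ := eq_pos_convex_span_of_mem_convexHull hx
      have hcard : Fintype.card ι ≤ Fintype.card (Fin N) := by
        rw [Fintype.card_fin]
        exact hind.card_le_finrank_succ.trans
          (Nat.succ_le_succ (Submodule.finrank_le _))
      obtain ⟨e⟩ := Function.Embedding.nonempty_of_card_le hcard
      obtain ⟨i₀⟩ : Nonempty ι := by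
        by_contra h
        rw [not_nonempty_iff] at h
        simp at hw1
      have hz' : ∀ i, z i ∈ s := fun i => hz ⟨i, rfl⟩
      refine ⟨(Function.extend e w 0, Function.extend e z fun _ => z i₀),
        ⟨⟨fun j => ?_, ?_⟩, fun j _ => ?_⟩, ?_⟩
      · by_cases h : ∃ i, e i = j
        · obtain ⟨i, rfl⟩ := h
          simpa [e.injective.extend_apply] using (hw i).le
        · simp [Function.extend_apply' _ _ _ h]
      · rw [← hw1]
        refine (Fintype.sum_of_injective e e.injective _ _ (fun j h => ?_) fun i => ?_).symm
        · simp [Function.extend_apply' _ _ _ (by simpa using h)]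
        · simp [e.injective.extend_apply]
      · by_cases h : ∃ i, e i = j
        · obtain ⟨i, rfl⟩ := h
          simpa [e.injective.extend_apply] using hz' i
        · simpa [Function.extend_apply' _ _ _ h] using hz' i₀
      · refine (Fintype.sum_of_injective e e.injective _ _ (fun j h => ?_) fun i => ?_).symm
        · simp [Function.extend_apply' _ _ _ (by simpa using h)]
        · simp [e.injective.extend_apply]
    · rintro _ ⟨⟨w, z⟩, ⟨⟨hw, hw1⟩, hz⟩, rfl⟩
      exact (convex_convexHull ℝ s).sum_mem (fun i _ => hw i) hw1
        fun i _ => subset_convexHull ℝ s (hz i trivial)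
  rw [himg]
  exact ((isCompact_stdSimplex ℝ (Fin N)).prod (isCompact_univ_pi fun _ => hs)).image hf

section
attribute [local instance] Matrix.normedAddCommGroup Matrix.normedSpace

/-- Matrices of determinant modulus one in a closed homogeneous set of matrices whose nonzero
members are invertible form a compact set. -/
theorem isCompact_inter_norm_det_eq_one {m : Type*} [Fintype m] [DecidableEq m] [Nonempty m]
    {T : Set (Matrix m m ℂ)} (hT : IsClosed T)
    (hsmul : ∀ r : ℝ, 0 ≤ r → ∀ X ∈ T, (r : ℂ) • X ∈ T)
    (hdet : ∀ X ∈ T, X ≠ 0 → X.det ≠ 0) : IsCompact {X ∈ T | ‖X.det‖ = 1} := by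
  have hcont : Continuous fun X : Matrix m m ℂ => ‖X.det‖ := by fun_prop
  have hclosed : IsClosed {X ∈ T | ‖X.det‖ = 1} :=
    hT.inter (isClosed_eq hcont continuous_const)
  rcases Set.eq_empty_or_nonempty (T ∩ Metric.sphere 0 1) with hK | hK
  · convert isCompact_empty
    ext X
    simp only [Set.mem_ofPred_eq, Set.mem_empty_iff_false, iff_false, not_and]
    intro hX h1
    have hX0 : X ≠ 0 := by rintro rfl; simp [Matrix.det_zero] at h1
    have : ((‖X‖⁻¹ : ℝ) : ℂ) • X ∈ T ∩ Metric.sphere 0 1 := by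
      refine ⟨hsmul _ (by positivity) X hX, ?_⟩
      simp [norm_smul, norm_ne_zero_iff.2 hX0]
    rw [hK] at this
    exact this
  have hKc : IsCompact (T ∩ Metric.sphere 0 1) := (isCompact_sphere 0 1).inter_left hT
  obtain ⟨Z, hZ, hmin⟩ := hKc.exists_isMinOn hK hcont.continuousOn
  have hZ0 : Z ≠ 0 := by
    rintro rfl
    simpa using hZ.2
  have hc : 0 < ‖Z.det‖ := norm_pos_iff.2 (hdet Z hZ.1 hZ0)
  refine Metric.isCompact_of_isClosed_isBounded hclosed
    (isBounded_iff_forall_norm_le.2 ⟨max 1 ‖Z.det‖⁻¹, ?_⟩)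
  rintro X ⟨hX, h1⟩
  rcases le_total ‖X‖ 1 with hle | hle
  · exact hle.trans (le_max_left _ _)
  have hX0 : ‖X‖ ≠ 0 := by linarith
  have hmem : ((‖X‖⁻¹ : ℝ) : ℂ) • X ∈ T ∩ Metric.sphere 0 1 := by
    refine ⟨hsmul _ (by positivity) X hX, ?_⟩
    simp [norm_smul, hX0]
  have h2 : ‖Z.det‖ ≤ ‖(((‖X‖⁻¹ : ℝ) : ℂ) • X).det‖ := hmin hmem
  rw [Matrix.det_smul, norm_mul, h1, mul_one, norm_pow, Complex.norm_real, norm_inv, norm_norm,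
    inv_pow] at h2
  refine le_trans ?_ (le_max_right _ _)
  calc ‖X‖ ≤ ‖X‖ ^ Fintype.card m := le_self_pow₀ hle Fintype.card_ne_zero
    _ ≤ ‖Z.det‖⁻¹ := by
      rw [le_inv_comm₀ (by positivity) hc]
      exact h2
end

/-- In a compact semigroup of invertible matrices every element has a right inverse, and the
semigroup contains the identity. -/
theorem exists_right_inverse_of_isCompact {m : Type*} [Fintype m] [DecidableEq m]
    {G : Set (Matrix m m ℂ)} (hG : IsCompact G) (hmul : ∀ X ∈ G, ∀ Y ∈ G, X * Y ∈ G)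
    (hdet : ∀ X ∈ G, X.det ≠ 0) {g : Matrix m m ℂ} (hg : g ∈ G) : ∃ h ∈ G, g * h = 1 := by
  obtain ⟨e, ⟨t, ht, rfl⟩, he⟩ := exists_idempotent_in_compact_subsemigroup
    (M := Matrix m m ℂ) (fun r => by fun_prop) ((fun t => g * t) '' G) ⟨_, g, hg, rfl⟩
    (hG.image (by fun_prop)) (by
      rintro _ ⟨t, ht, rfl⟩ _ ⟨t', ht', rfl⟩
      exact ⟨t * (g * t'), hmul _ ht _ (hmul _ hg _ ht'), by simp [Matrix.mul_assoc]⟩)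
  refine ⟨t, ht, ?_⟩
  have hu : IsUnit (g * t) := by
    rw [Matrix.isUnit_iff_isUnit_det, isUnit_iff_ne_zero]
    exact hdet _ (hmul _ hg _ ht)
  exact hu.mul_left_cancel (by simpa using he)

/-- The convex hull of a compact semigroup of invertible matrices contains a point fixed by left
multiplication by the semigroup. -/
theorem exists_fixed_mem_convexHull {m : Type*} [Fintype m] [DecidableEq m]
    {G : Set (Matrix m m ℂ)} (hG : IsCompact G) (hne : G.Nonempty)
    (hmul : ∀ X ∈ G, ∀ Y ∈ G, X * Y ∈ G) (hdet : ∀ X ∈ G, X.det ≠ 0) :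
    ∃ P ∈ convexHull ℝ G, ∀ g ∈ G, g * P = P := by
  let q : Matrix m m ℂ → ℝ := fun X => ∑ i, ∑ j, ‖X i j‖ ^ 2
  have hq : Continuous q := by fun_prop
  have hpar : ∀ X Y, q ((1 / 2 : ℝ) • X + (1 / 2 : ℝ) • Y) =
      (q X + q Y) / 2 - q (X - Y) / 4 := by
    intro X Y
    simp only [q, Finset.sum_div, ← Finset.sum_add_distrib, ← Finset.sum_sub_distrib]
    refine Finset.sum_congr rfl fun i _ => Finset.sum_congr rfl fun j _ => ?_
    have h := parallelogram_law_with_norm ℝ (X i j) (Y i j)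
    have h2 : ((1 / 2 : ℝ) • X + (1 / 2 : ℝ) • Y) i j = (1 / 2 : ℝ) • (X i j + Y i j) := by
      simp [smul_add]
    rw [h2, norm_smul, Matrix.sub_apply]
    norm_num
    nlinarith
  let F : Matrix m m ℂ → ℝ := fun X => sSup ((fun g => q (g * X)) '' G)
  have hF : Continuous F :=
    hG.continuous_sSup (f := fun X g => q (g * X)) (hq.comp (by fun_prop))
  have hbdd : ∀ X, BddAbove ((fun g => q (g * X)) '' G) := fun X =>
    (hG.image (hq.comp (by fun_prop))).bddAbove
  have hle : ∀ X, ∀ g ∈ G, q (g * X) ≤ F X := fun X g hg => le_csSup (hbdd X) ⟨g, hg, rfl⟩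
  obtain ⟨P, hP, hmin⟩ := (isCompact_convexHull_of_isCompact hG).exists_isMinOn
    hne.convexHull hF.continuousOn
  refine ⟨P, hP, fun h hh => ?_⟩
  have hhP : h * P ∈ convexHull ℝ G := by
    have := Set.mem_image_of_mem (LinearMap.mulLeft ℝ h) hP
    rw [(LinearMap.mulLeft ℝ h).image_convexHull] at this
    refine convexHull_mono ?_ this
    rintro _ ⟨x, hx, rfl⟩
    exact hmul _ hh _ hx
  have hM : (1 / 2 : ℝ) • P + (1 / 2 : ℝ) • (h * P) ∈ convexHull ℝ G :=
    convex_convexHull ℝ G hP hhP (by norm_num) (by norm_num) (by norm_num)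
  obtain ⟨g, hg, hgM⟩ := (hG.image (f := fun g => q (g * ((1 / 2 : ℝ) • P +
    (1 / 2 : ℝ) • (h * P)))) (hq.comp (by fun_prop))).sSup_mem (hne.image _)
  have h1 : F P ≤ q (g * ((1 / 2 : ℝ) • P + (1 / 2 : ℝ) • (h * P))) :=
    (hmin hM).trans hgM.ge
  rw [Matrix.mul_add, Matrix.mul_smul, Matrix.mul_smul, hpar] at h1
  have h2 := hle P g hg
  have h3 := hle P (g * h) (hmul _ hg _ hh)
  rw [Matrix.mul_assoc] at h3
  have h4 : q (g * P - g * (h * P)) ≤ 0 := by linarith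
  have h5 : g * P - g * (h * P) = 0 := by
    have hnn : ∀ i ∈ Finset.univ, 0 ≤ ∑ j, ‖(g * P - g * (h * P)) i j‖ ^ 2 :=
      fun i _ => Finset.sum_nonneg fun j _ => by positivity
    have h6 := (Finset.sum_eq_zero_iff_of_nonneg hnn).1 (h4.antisymm (Finset.sum_nonneg hnn))
    ext i j
    have h7 := (Finset.sum_eq_zero_iff_of_nonneg fun j _ => by positivity).1
      (h6 i (Finset.mem_univ i)) j (Finset.mem_univ j)
    simpa using h7
  have hu : IsUnit g := by
    rw [Matrix.isUnit_iff_isUnit_det, isUnit_iff_ne_zero]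
    exact hdet _ hg
  exact (hu.mul_left_cancel (sub_eq_zero.1 h5)).symm

/-- The convex hull of a compact group of matrices with nonnegative traces omits zero. -/
theorem zero_notMem_convexHull_of_trace_nonneg {m : Type*} [Fintype m] [DecidableEq m]
    [Nonempty m] {G : Set (Matrix m m ℂ)} (hmul : ∀ X ∈ G, ∀ Y ∈ G, X * Y ∈ G)
    (hinv : ∀ X ∈ G, ∃ Y ∈ G, X * Y = 1) (htr : ∀ X ∈ G, 0 ≤ X.trace) :
    (0 : Matrix m m ℂ) ∉ convexHull ℝ G := by
  intro h0
  obtain ⟨ι, _, w, z, hw, hw1, hz, hsum⟩ := mem_convexHull_iff_exists_fintype.1 h0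
  obtain ⟨j, -, hj⟩ : ∃ j ∈ Finset.univ, w j ≠ 0 := by
    apply Finset.exists_ne_zero_of_sum_ne_zero
    rw [hw1]; exact one_ne_zero
  obtain ⟨y, hy, hzy⟩ := hinv _ (hz j)
  have h1 : ∑ i, w i * (z i * y).trace.re = 0 := by
    have := congrArg (fun M => (M * y).trace.re) hsum
    simpa [Finset.sum_mul, Matrix.trace_sum] using this
  have hre : ∀ i, 0 ≤ (z i * y).trace.re := fun i =>
    (Complex.nonneg_iff.1 (htr _ (hmul _ (hz i) _ hy))).1
  have h2 := (Finset.sum_eq_zero_iff_of_nonneg fun i _ => mul_nonneg (hw i) (hre i)).1 h1 j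
    (Finset.mem_univ j)
  rw [hzy, Matrix.trace_one] at h2
  simp [hj] at h2

/-- A closed homogeneous semigroup of matrices with nonnegative traces, whose nonzero members are
invertible, contains the identity and acts by scalars on some nonzero vector. -/
theorem one_mem_and_exists_common_eigenvector {m : Type*} [Fintype m] [DecidableEq m]
    [Nonempty m] {T : Set (Matrix m m ℂ)} (hT : IsClosed T)
    (hmul : ∀ X ∈ T, ∀ Y ∈ T, X * Y ∈ T)
    (hsmul : ∀ r : ℝ, 0 ≤ r → ∀ X ∈ T, (r : ℂ) • X ∈ T)
    (hdet : ∀ X ∈ T, X ≠ 0 → X.det ≠ 0) (htr : ∀ X ∈ T, 0 ≤ X.trace)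
    (hne : ∃ X ∈ T, X ≠ 0) :
    1 ∈ T ∧ ∃ w : m → ℂ, w ≠ 0 ∧ ∀ X ∈ T, ∃ c : ℂ, X *ᵥ w = c • w := by
  let G := {X ∈ T | ‖X.det‖ = 1}
  have hGc : IsCompact G := isCompact_inter_norm_det_eq_one hT hsmul hdet
  have hGdet : ∀ X ∈ G, X.det ≠ 0 := fun X hX h => by
    have := hX.2
    simp [h] at this
  have hGmul : ∀ X ∈ G, ∀ Y ∈ G, X * Y ∈ G := fun X hX Y hY =>
    ⟨hmul _ hX.1 _ hY.1, by rw [Matrix.det_mul, norm_mul, hX.2, hY.2, one_mul]⟩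
  have hnorm : ∀ X ∈ T, X ≠ 0 → ∃ r : ℝ, 0 < r ∧ (r : ℂ) • X ∈ G := by
    intro X hX hX0
    have hd : 0 < ‖X.det‖ := norm_pos_iff.2 (hdet X hX hX0)
    refine ⟨(‖X.det‖⁻¹) ^ ((Fintype.card m : ℝ)⁻¹), by positivity,
      hsmul _ (by positivity) X hX, ?_⟩
    rw [Matrix.det_smul, norm_mul, norm_pow, Complex.norm_real,
      Real.norm_of_nonneg (by positivity),
      Real.rpow_inv_natCast_pow (by positivity) Fintype.card_ne_zero, inv_mul_cancel₀ hd.ne']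
  obtain ⟨g, hg⟩ : G.Nonempty := by
    obtain ⟨X, hX, hX0⟩ := hne
    obtain ⟨r, -, hr⟩ := hnorm X hX hX0
    exact ⟨_, hr⟩
  have hinv : ∀ X ∈ G, ∃ Y ∈ G, X * Y = 1 := fun X hX =>
    exists_right_inverse_of_isCompact hGc hGmul hGdet hX
  obtain ⟨P, hP, hfix⟩ := exists_fixed_mem_convexHull hGc ⟨g, hg⟩ hGmul hGdet
  have hP0 : P ≠ 0 := by
    rintro rfl
    exact zero_notMem_convexHull_of_trace_nonneg hGmul hinv (fun X hX => htr X hX.1) hP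
  refine ⟨?_, ?_⟩
  · obtain ⟨h, hh, hgh⟩ := hinv g hg
    rw [← hgh]
    exact (hGmul _ hg _ hh).1
  · obtain ⟨k, hk⟩ : ∃ k, P.col k ≠ 0 := by
      by_contra! h
      exact hP0 (by ext i k; exact congrFun (h k) i)
    refine ⟨P.col k, hk, fun X hX => ?_⟩
    by_cases hX0 : X = 0
    · exact ⟨0, by simp [hX0]⟩
    obtain ⟨r, hr, hrX⟩ := hnorm X hX hX0
    refine ⟨(r : ℂ)⁻¹, ?_⟩
    have h1 := congrArg (fun M : Matrix m m ℂ => M.col k) (hfix _ hrX)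
    have h2 : (((r : ℂ) • X) * P).col k = (r : ℂ) • (X *ᵥ P.col k) := by
      ext i
      simp [Matrix.mul_apply, Matrix.mulVec, dotProduct, Finset.mul_sum]
    have hr' : (r : ℂ) ≠ 0 := by exact_mod_cast hr.ne'
    simp only [h2] at h1
    conv_rhs => rw [← h1]
    rw [smul_smul, inv_mul_cancel₀ hr', one_smul]

/-- Rank factorization. -/
theorem exists_eq_mul_of_rank {l n K : Type*} [Field K] [Fintype l] [Fintype n] [DecidableEq n]
    (A : Matrix l n K) :
    ∃ (U : Matrix l (Fin A.rank) K) (W : Matrix (Fin A.rank) n K), A = U * W := by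
  let b := Module.finBasisOfFinrankEq K (LinearMap.range A.mulVecLin) (n := A.rank) rfl
  let c : n → LinearMap.range A.mulVecLin := fun j => ⟨A *ᵥ Pi.single j 1, _, rfl⟩
  refine ⟨Matrix.of fun i k => (b k).1 i, Matrix.of fun k j => b.repr (c j) k, ?_⟩
  ext i j
  have h : (∑ k, b.repr (c j) k • b k : LinearMap.range A.mulVecLin).1 i = (c j).1 i := by
    rw [b.sum_repr]
  simp only [Submodule.coe_sum, Submodule.coe_smul, Finset.sum_apply, Pi.smul_apply,
    smul_eq_mul] at h
  simpa [c, Matrix.mul_apply, mul_comm] using h.symm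

theorem det_ne_zero_of_card_le_rank {m K : Type*} [Field K] [Fintype m] [DecidableEq m]
    {X : Matrix m m K} (hX : Fintype.card m ≤ X.rank) : X.det ≠ 0 := by
  rw [← isUnit_iff_ne_zero, ← Matrix.isUnit_iff_isUnit_det,
    ← Matrix.mulVec_surjective_iff_isUnit]
  have : LinearMap.range X.mulVecLin = ⊤ :=
    Submodule.eq_top_of_finrank_eq
      (le_antisymm (Submodule.finrank_le _) (by simpa [Matrix.rank] using hX))
  exact LinearMap.range_eq_top.1 this

theorem exists_mul_eq_vecMulVec {l m n K : Type*} [Field K] [Fintype m] [Subsingleton m]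
    (U : Matrix l m K) (V : Matrix m n K) : ∃ a b, U * V = vecMulVec a b := by
  rcases isEmpty_or_nonempty m with h | ⟨⟨k⟩⟩
  · exact ⟨0, 0, by ext; simp [Matrix.mul_apply]⟩
  · have : Unique m := ⟨⟨k⟩, fun _ => Subsingleton.elim _ _⟩
    exact ⟨U.col default, V.row default, by ext; simp [Matrix.mul_apply, vecMulVec_apply]⟩

theorem exists_eq_vecMulVec_of_rank_le_one {l n K : Type*} [Field K] [Fintype l] [Fintype n]
    [DecidableEq n] {A : Matrix l n K} (hA : A.rank ≤ 1) : ∃ a b, A = vecMulVec a b := by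
  obtain ⟨U, W, h⟩ := exists_eq_mul_of_rank A
  have : Subsingleton (Fin A.rank) := Fin.subsingleton_iff_le_one.2 hA
  rw [h]
  exact exists_mul_eq_vecMulVec U W

/-- A set of vectors which no nonzero vector annihilates spans. -/
theorem span_eq_top_of_dotProduct_ne_zero {ι K : Type*} [Field K] [Fintype ι] [DecidableEq ι]
    {X : Set (ι → K)} (hX : ∀ w : ι → K, w ≠ 0 → ∃ x ∈ X, w ⬝ᵥ x ≠ 0) :
    Submodule.span K X = ⊤ := by
  by_contra h
  obtain ⟨f, hf, hle⟩ := Submodule.exists_le_ker_of_lt_top _ (lt_top_iff_ne_top.2 h)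
  have hfx : ∀ x, f x = (fun i => f (Pi.single i 1)) ⬝ᵥ x := by
    intro x
    rw [LinearMap.pi_apply_eq_sum_univ f x]
    simp only [dotProduct, smul_eq_mul, mul_comm]
    refine Finset.sum_congr rfl fun i _ => ?_
    congr 2
    ext j
    simp [Pi.single_apply, eq_comm]
  obtain ⟨x, hx, hne⟩ := hX (fun i => f (Pi.single i 1)) (by
    intro h0
    apply hf
    ext x
    simpa [h0] using hfx (Pi.single x 1))
  rw [← hfx] at hne
  exact hne (hle (Submodule.subset_span hx))

/-- Irreducibility separates pairs of nonzero vectors. -/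
theorem exists_dotProduct_mulVec_ne_zero {n : ℕ} (hn : 2 ≤ n)
    {S : Set (Matrix (Fin n) (Fin n) ℂ)} (hsemi : ∀ A ∈ S, ∀ B ∈ S, A * B ∈ S)
    (hirr : ∀ p : Submodule ℂ (Fin n → ℂ),
      (∀ A ∈ S, ∀ v ∈ p, A.mulVec v ∈ p) → p = ⊥ ∨ p = ⊤)
    {v w : Fin n → ℂ} (hv : v ≠ 0) (hw : w ≠ 0) : ∃ B ∈ S, w ⬝ᵥ B *ᵥ v ≠ 0 := by
  by_contra! h
  have hinv : ∀ A ∈ S, ∀ x ∈ Submodule.span ℂ ((fun B => B *ᵥ v) '' S),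
      A *ᵥ x ∈ Submodule.span ℂ ((fun B => B *ᵥ v) '' S) := by
    intro A hA x hx
    induction hx using Submodule.span_induction with
    | mem x hx =>
      obtain ⟨B, hB, rfl⟩ := hx
      exact Submodule.subset_span ⟨A * B, hsemi _ hA _ hB, by simp⟩
    | zero => simp
    | add x y _ _ hx hy => rw [mulVec_add]; exact add_mem hx hy
    | smul c x _ hx => rw [mulVec_smul]; exact Submodule.smul_mem _ _ hx
  rcases hirr _ hinv with h0 | h1
  · have hz : ∀ B ∈ S, B *ᵥ v = 0 := fun B hB => by
      have : B *ᵥ v ∈ Submodule.span ℂ ((fun B => B *ᵥ v) '' S) :=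
        Submodule.subset_span ⟨B, hB, rfl⟩
      rwa [h0, Submodule.mem_bot] at this
    rcases hirr (Submodule.span ℂ {v}) (by
      intro A hA x hx
      obtain ⟨c, rfl⟩ := Submodule.mem_span_singleton.1 hx
      simp [mulVec_smul, hz A hA]) with h2 | h2
    · exact hv (by simpa using h2)
    · have := finrank_span_le_card (R := ℂ) ({v} : Set (Fin n → ℂ))
      rw [h2, finrank_top] at this
      simp at this
      omega
  · have hz : ∀ x : Fin n → ℂ, w ⬝ᵥ x = 0 := by
      intro x
      have hx : x ∈ Submodule.span ℂ ((fun B => B *ᵥ v) '' S) := h1 ▸ Submodule.mem_top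
      induction hx using Submodule.span_induction with
      | mem x hx =>
        obtain ⟨B, hB, rfl⟩ := hx
        exact h B hB
      | zero => simp
      | add x y _ _ hx hy => simp [hx, hy]
      | smul c x _ hx => simp [hx]
    exact hw (dotProduct_eq_zero w hz)

/-- A closed homogeneous semigroup of matrices with nonnegative diagonals which separates pairs of
nonzero vectors contains a rank-one matrix with positive trace. -/
theorem exists_vecMulVec_mem {n : ℕ} [NeZero n] {S : Set (Matrix (Fin n) (Fin n) ℂ)}
    (hsemi : ∀ A ∈ S, ∀ B ∈ S, A * B ∈ S) (hclosed : IsClosed S)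
    (hsmul : ∀ r : ℝ, 0 ≤ r → ∀ A ∈ S, (r : ℂ) • A ∈ S)
    (hsep : ∀ v w : Fin n → ℂ, v ≠ 0 → w ≠ 0 → ∃ B ∈ S, w ⬝ᵥ B *ᵥ v ≠ 0)
    (hdiag : ∀ A ∈ S, ∀ i, 0 ≤ A i i) :
    ∃ u v, vecMulVec u v ∈ S ∧ 0 < v ⬝ᵥ u := by
  let e : Fin n → ℂ := Pi.single 0 1
  have he : e ≠ 0 := by simp [e]
  have htrS : ∀ A ∈ S, 0 ≤ A.trace := fun A hA => Finset.sum_nonneg fun i _ => hdiag A hA i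
  obtain ⟨A₀, ⟨hA₀, hA₀0⟩, hmin⟩ : ∃ A ∈ {A ∈ S | A ≠ 0}, ∀ B ∈ {A ∈ S | A ≠ 0},
      A.rank ≤ B.rank := by
    have hne : {A ∈ S | A ≠ 0}.Nonempty := by
      obtain ⟨B, hB, hB0⟩ := hsep e e he he
      exact ⟨B, hB, by rintro rfl; simp at hB0⟩
    refine ⟨Function.argminOn Matrix.rank _ hne, Function.argminOn_mem _ _ _, fun B hB =>
      Function.argminOn_le _ _ hB⟩
  obtain ⟨A, hA, htrA, hrank⟩ : ∃ A ∈ S, A.trace ≠ 0 ∧ A.rank ≤ A₀.rank := by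
    obtain ⟨i, hi⟩ : ∃ i, A₀.row i ≠ 0 := by
      by_contra! h
      exact hA₀0 (by ext i j; exact congrFun (h i) j)
    obtain ⟨C, hC, hC0⟩ := hsep e _ he hi
    obtain ⟨B, hB, hB0⟩ := hsep (A₀ *ᵥ (C *ᵥ e)) e (by
      intro h
      exact hC0 (congrFun h i)) he
    refine ⟨B * (A₀ * C), hsemi _ hB _ (hsemi _ hA₀ _ hC), ?_,
      (rank_mul_le_right _ _).trans (rank_mul_le_left _ _)⟩
    have hmem := hsemi _ hB _ (hsemi _ hA₀ _ hC)
    intro h0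
    apply hB0
    have := (Finset.sum_eq_zero_iff_of_nonneg fun i _ => hdiag _ hmem i).1 h0 0 (Finset.mem_univ 0)
    rw [mulVec_mulVec, mulVec_mulVec, Matrix.mul_assoc]
    simpa [e] using this
  have hA0 : A ≠ 0 := by rintro rfl; simp at htrA
  have hmin' : ∀ B ∈ S, B ≠ 0 → A.rank ≤ B.rank := fun B hB hB0 => hrank.trans (hmin B ⟨hB, hB0⟩)
  have hAA : A * A ≠ 0 := by
    intro h
    have : IsNilpotent A := ⟨2, by rw [pow_two, h]⟩
    exact htrA (Matrix.isNilpotent_trace_of_isNilpotent this).eq_zero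
  obtain ⟨U, W, hUW⟩ := exists_eq_mul_of_rank A
  have hunit : (W * U).det ≠ 0 := by
    apply det_ne_zero_of_card_le_rank
    have h : A * A = U * ((W * U) * W) := by
      conv_lhs => rw [hUW]
      simp only [Matrix.mul_assoc]
    rw [Fintype.card_fin]
    refine (hmin' _ (hsemi _ hA _ hA) hAA).trans ?_
    rw [h]
    exact (rank_mul_le_right _ _).trans (rank_mul_le_left _ _)
  obtain ⟨V, hV⟩ : ∃ V, V = (W * U)⁻¹ * W := ⟨_, rfl⟩
  have hVU : V * U = 1 := by
    rw [hV, Matrix.mul_assoc, Matrix.nonsing_inv_mul _ (isUnit_iff_ne_zero.2 hunit)]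
  have hAX : A = U * (W * U) * V := by
    rw [hV, Matrix.mul_assoc U, Matrix.mul_nonsing_inv_cancel_left _ _ (isUnit_iff_ne_zero.2 hunit)]
    exact hUW
  have hback : ∀ X : Matrix (Fin A.rank) (Fin A.rank) ℂ, V * (U * X * V) * U = X := by
    intro X
    calc V * (U * X * V) * U = (V * U) * X * (V * U) := by simp only [Matrix.mul_assoc]
      _ = X := by rw [hVU, Matrix.one_mul, Matrix.mul_one]
  have hpos : A.rank ≠ 0 := by
    intro h
    have : IsEmpty (Fin A.rank) := by rw [h]; infer_instance
    exact hA0 (by rw [hUW]; ext; simp [Matrix.mul_apply])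
  have : Nonempty (Fin A.rank) := ⟨⟨0, Nat.pos_of_ne_zero hpos⟩⟩
  obtain ⟨hone, w, hw, heig⟩ := one_mem_and_exists_common_eigenvector
    (T := {X : Matrix (Fin A.rank) (Fin A.rank) ℂ | U * X * V ∈ S})
    (hclosed.preimage (by fun_prop))
    (fun X hX Y hY => by
      have := hsemi _ hX _ hY
      have h2 : U * X * V * (U * Y * V) = U * (X * Y) * V := by
        calc U * X * V * (U * Y * V) = U * X * (V * U) * Y * V := by simp only [Matrix.mul_assoc]
          _ = _ := by rw [hVU, Matrix.mul_one, Matrix.mul_assoc U]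
      rwa [h2] at this)
    (fun r hr X hX => by
      have := hsmul r hr _ hX
      simpa using this)
    (fun X hX hX0 => by
      apply det_ne_zero_of_card_le_rank
      rw [Fintype.card_fin]
      refine (hmin' _ hX fun h => hX0 ?_).trans
        ((rank_mul_le_left _ _).trans (rank_mul_le_right _ _))
      rw [← hback X, h, Matrix.mul_zero, Matrix.zero_mul])
    (fun X hX => by
      have := htrS _ hX
      rwa [Matrix.trace_mul_comm, ← Matrix.mul_assoc, hVU, Matrix.one_mul] at this)
    ⟨W * U, by simpa [← hAX] using hA, by rintro h; simp [h] at hunit⟩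
  rw [Set.mem_ofPred_eq, Matrix.mul_one] at hone
  have hUw : U *ᵥ w ≠ 0 := by
    intro h
    apply hw
    have := congrArg (V *ᵥ ·) h
    simpa [hVU] using this
  have hz : ∀ z : Fin A.rank → ℂ, z ⬝ᵥ w = 0 → z = 0 := by
    intro z hzw
    by_contra hz0
    have hzV : z ᵥ* V ≠ 0 := by
      intro h
      apply hz0
      have := congrArg (· ᵥ* U) h
      simpa [hVU] using this
    obtain ⟨B, hB, hB0⟩ := hsep _ _ hUw hzV
    obtain ⟨c, hc⟩ := heig (V * B * U) (by
      have := hsemi _ (hsemi _ hone _ hB) _ hone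
      simpa only [Set.mem_ofPred_eq, Matrix.mul_assoc] using this)
    apply hB0
    rw [← Matrix.dotProduct_mulVec, mulVec_mulVec, mulVec_mulVec, hc]
    simp [hzw]
  have hsub : Subsingleton (Fin A.rank) := by
    refine ⟨fun k l => ?_⟩
    by_contra hkl
    have h1 := hz (Pi.single k (w l) - Pi.single l (w k)) (by simp [mul_comm])
    have h3 := hz (Pi.single l 1) (by simpa [hkl] using congrFun h1 k)
    simpa using congrFun h3 l
  obtain ⟨u, v, huv⟩ := exists_mul_eq_vecMulVec U V
  refine ⟨u, v, huv ▸ hone, ?_⟩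
  rw [dotProduct_comm, ← Matrix.trace_vecMulVec, ← huv, Matrix.trace_mul_comm, hVU,
    Matrix.trace_one]
  simpa using Nat.pos_of_ne_zero hpos

/-- The members of rank at most one of a homogeneous separating semigroup with nonnegative
diagonals are exactly the products `x yᵀ`, with `x` and `y` ranging over two invariant separating
sets between which all pairings through the semigroup are nonnegative. -/
theorem exists_rank_le_one_eq_vecMulVec {n : ℕ} {S : Set (Matrix (Fin n) (Fin n) ℂ)}
    (hsemi : ∀ A ∈ S, ∀ B ∈ S, A * B ∈ S) (hclosed : IsClosed S)
    (hsmul : ∀ r : ℝ, 0 ≤ r → ∀ A ∈ S, (r : ℂ) • A ∈ S)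
    (hsep : ∀ v w : Fin n → ℂ, v ≠ 0 → w ≠ 0 → ∃ B ∈ S, w ⬝ᵥ B *ᵥ v ≠ 0)
    (hdiag : ∀ A ∈ S, ∀ i, 0 ≤ A i i)
    {x₀ y₀ : Fin n → ℂ} (h₀ : vecMulVec x₀ y₀ ∈ S) (hpos : 0 < y₀ ⬝ᵥ x₀) :
    ∃ P Q : Set (Fin n → ℂ), IsClosed P ∧ (∀ A ∈ S, ∀ x ∈ P, A *ᵥ x ∈ P) ∧
      (∀ r : ℝ, 0 ≤ r → ∀ x ∈ P, (r : ℂ) • x ∈ P) ∧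
      (∀ w, w ≠ 0 → ∃ x ∈ P, w ⬝ᵥ x ≠ 0) ∧ (∀ w, w ≠ 0 → ∃ y ∈ Q, y ⬝ᵥ w ≠ 0) ∧
      (∀ x ∈ P, ∀ y ∈ Q, ∀ i, 0 ≤ y i * x i) ∧
      (∀ A ∈ S, ∀ x ∈ P, ∀ y ∈ Q, 0 ≤ y ⬝ᵥ A *ᵥ x) ∧
      ∀ A, (A ∈ S ∧ A.rank ≤ 1) ↔ ∃ x ∈ P, ∃ y ∈ Q, A = vecMulVec x y := by
  have hsmul' : ∀ c : ℂ, 0 ≤ c → ∀ A ∈ S, c • A ∈ S := by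
    intro c hc A hA
    obtain ⟨hre, him⟩ := Complex.nonneg_iff.1 hc
    have : c = (c.re : ℂ) := Complex.ext rfl him.symm
    rw [this]
    exact hsmul _ hre A hA
  have htr : ∀ A ∈ S, 0 ≤ A.trace := fun A hA => Finset.sum_nonneg fun i _ => hdiag A hA i
  have hx₀ : x₀ ≠ 0 := by rintro rfl; simp at hpos
  have hy₀ : y₀ ≠ 0 := by rintro rfl; simp at hpos
  let P : Set (Fin n → ℂ) := {x | vecMulVec x y₀ ∈ S}
  let Q : Set (Fin n → ℂ) := {y | vecMulVec x₀ y ∈ S}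
  have hPQ : ∀ x ∈ P, ∀ y ∈ Q, vecMulVec x y ∈ S := by
    intro x hx y hy
    have h := hsmul' (y₀ ⬝ᵥ x₀)⁻¹ (inv_nonneg.2 hpos.le) _ (hsemi _ hx _ hy)
    rwa [vecMulVec_mul_vecMulVec, vecMulVec_smul, smul_smul, inv_mul_cancel₀ hpos.ne',
      one_smul] at h
  have hpair : ∀ x y, vecMulVec x y ∈ S → ∀ A ∈ S, 0 ≤ y ⬝ᵥ A *ᵥ x := by
    intro x y hxy A hA
    have h := htr _ (hsemi _ hA _ hxy)
    rwa [mul_vecMulVec, trace_vecMulVec, dotProduct_comm] at h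
  have hQsmul : ∀ c : ℂ, 0 ≤ c → ∀ y ∈ Q, c • y ∈ Q := by
    intro c hc y hy
    change vecMulVec _ _ ∈ S
    rw [vecMulVec_smul]
    exact hsmul' c hc _ hy
  have hPsmul : ∀ r : ℝ, 0 ≤ r → ∀ x ∈ P, (r : ℂ) • x ∈ P := by
    intro r hr x hx
    change vecMulVec _ _ ∈ S
    rw [smul_vecMulVec]
    exact hsmul r hr _ hx
  refine ⟨P, Q, ?_, ?_, hPsmul, ?_, ?_, ?_, ?_, ?_⟩
  · exact hclosed.preimage (f := fun x => vecMulVec x y₀) (by fun_prop)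
  · intro A hA x hx
    change vecMulVec _ _ ∈ S
    rw [← mul_vecMulVec]
    exact hsemi _ hA _ hx
  · intro w hw
    obtain ⟨B, hB, hne⟩ := hsep x₀ w hx₀ hw
    refine ⟨B *ᵥ x₀, ?_, hne⟩
    change vecMulVec _ _ ∈ S
    rw [← mul_vecMulVec]
    exact hsemi _ hB _ h₀
  · intro w hw
    obtain ⟨B, hB, hne⟩ := hsep w y₀ hw hy₀
    refine ⟨y₀ ᵥ* B, ?_, by rwa [← dotProduct_mulVec]⟩
    change vecMulVec _ _ ∈ S
    rw [← vecMulVec_mul]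
    exact hsemi _ h₀ _ hB
  · intro x hx y hy i
    simpa [vecMulVec_apply, mul_comm] using hdiag _ (hPQ x hx y hy) i
  · exact fun A hA x hx y hy => hpair x y (hPQ x hx y hy) A hA
  · intro A
    constructor
    · rintro ⟨hA, hrank⟩
      obtain ⟨a, b, rfl⟩ := exists_eq_vecMulVec_of_rank_le_one hrank
      by_cases hab : vecMulVec a b = 0
      · refine ⟨0, ?_, 0, ?_, by simp [hab]⟩
        · simpa using hPsmul 0 le_rfl x₀ h₀
        · simpa using hQsmul 0 le_rfl y₀ h₀
      obtain ⟨ha, hb⟩ := not_or.1 (mt vecMulVec_eq_zero.2 hab)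
      obtain ⟨B, hB, hl⟩ := hsep x₀ b hx₀ hb
      obtain ⟨C, hC, hm⟩ := hsep a y₀ ha hy₀
      obtain ⟨D, hD, hk⟩ := hsep a b ha hb
      have hPa : (b ⬝ᵥ B *ᵥ x₀) • a ∈ P := by
        have h := hsemi _ hA _ (hsemi _ hB _ h₀)
        rwa [mul_vecMulVec, vecMulVec_mul_vecMulVec, vecMulVec_smul, ← smul_vecMulVec] at h
      have hQb : (y₀ ⬝ᵥ C *ᵥ a) • b ∈ Q := by
        have h := hsemi _ h₀ _ (hsemi _ hC _ hA)
        rwa [mul_vecMulVec, vecMulVec_mul_vecMulVec] at h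
      have hDpos : 0 < b ⬝ᵥ D *ᵥ a := lt_of_le_of_ne (hpair a b hA D hD) hk.symm
      have hlm : 0 ≤ ((y₀ ⬝ᵥ C *ᵥ a) * (b ⬝ᵥ B *ᵥ x₀)) * (b ⬝ᵥ D *ᵥ a) := by
        have h := hpair _ _ (hPQ _ hPa _ hQb) D hD
        rwa [mulVec_smul, smul_dotProduct, dotProduct_smul, smul_eq_mul, smul_eq_mul,
          ← mul_assoc] at h
      have hc : 0 ≤ (y₀ ⬝ᵥ C *ᵥ a) * (b ⬝ᵥ B *ᵥ x₀) := by
        have h := mul_nonneg hlm (inv_nonneg.2 hDpos.le)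
        rwa [mul_assoc _ (b ⬝ᵥ D *ᵥ a), mul_inv_cancel₀ hk, mul_one] at h
      refine ⟨_, hPa, _, hQsmul _ (inv_nonneg.2 hc) _ hQb, ?_⟩
      have hone : (b ⬝ᵥ B *ᵥ x₀) *
          (((y₀ ⬝ᵥ C *ᵥ a) * (b ⬝ᵥ B *ᵥ x₀))⁻¹ * (y₀ ⬝ᵥ C *ᵥ a)) = 1 := by
        field_simp
      rw [smul_vecMulVec, vecMulVec_smul, vecMulVec_smul, smul_smul, smul_smul, mul_assoc, hone,
        one_smul]
    · rintro ⟨x, hx, y, hy, rfl⟩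
      exact ⟨hPQ x hx y hy, rank_vecMulVec_le _ _⟩

theorem coneGen_add_mem {n : ℕ} {X : Set (Fin n → ℝ)} {u v : Fin n → ℝ} (hu : u ∈ coneGen X)
    (hv : v ∈ coneGen X) : u + v ∈ coneGen X := by
  obtain ⟨k, c, x, hc, hx, rfl⟩ := hu
  obtain ⟨l, c', x', hc', hx', rfl⟩ := hv
  refine ⟨k + l, Fin.append c c', Fin.append x x', fun i => ?_, fun i => ?_, ?_⟩
  · induction i using Fin.addCases <;> simp [hc, hc']
  · induction i using Fin.addCases <;> simp [hx, hx']
  · simp [Fin.sum_univ_add]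

theorem coneGen_smul_mem {n : ℕ} {X : Set (Fin n → ℝ)} {r : ℝ} (hr : 0 ≤ r) {v : Fin n → ℝ}
    (hv : v ∈ coneGen X) : r • v ∈ coneGen X := by
  obtain ⟨k, c, x, hc, hx, rfl⟩ := hv
  exact ⟨k, fun i => r * c i, x, fun i => mul_nonneg hr (hc i), hx, by
    simp [Finset.smul_sum, smul_smul]⟩

theorem zero_mem_coneGen {n : ℕ} (X : Set (Fin n → ℝ)) : 0 ∈ coneGen X :=
  ⟨0, 0, fun _ => 0, by simp, fun i => i.elim0, by simp⟩

theorem subset_coneGen {n : ℕ} (X : Set (Fin n → ℝ)) : X ⊆ coneGen X := fun x hx =>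
  ⟨1, 1, fun _ => x, by simp, by simp [hx], by simp⟩

theorem convex_coneGen {n : ℕ} (X : Set (Fin n → ℝ)) : Convex ℝ (coneGen X) :=
  fun _ hu _ hv _ _ ha hb _ =>
    coneGen_add_mem (coneGen_smul_mem ha hu) (coneGen_smul_mem hb hv)

theorem coneGen_nonneg {n : ℕ} {X : Set (Fin n → ℝ)} (hX : ∀ x ∈ X, ∀ i, 0 ≤ x i)
    {v : Fin n → ℝ} (hv : v ∈ coneGen X) (i : Fin n) : 0 ≤ v i := by
  obtain ⟨k, c, x, hc, hx, rfl⟩ := hv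
  simpa using Finset.sum_nonneg fun j _ => mul_nonneg (hc j) (hX _ (hx j) i)

open scoped Pointwise in
/-- The cone generated by a closed homogeneous set of nonnegative vectors is closed. -/
theorem isClosed_coneGen {n : ℕ} {X : Set (Fin n → ℝ)} (hX : IsClosed X)
    (hsmul : ∀ r : ℝ, 0 ≤ r → ∀ x ∈ X, r • x ∈ X) (hnn : ∀ x ∈ X, ∀ i, 0 ≤ x i) :
    IsClosed (coneGen X) := by
  let B : Set (Fin n → ℝ) := X ∩ stdSimplex ℝ (Fin n)
  have hBc : IsCompact (convexHull ℝ B) :=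
    isCompact_convexHull_of_isCompact ((isCompact_stdSimplex ℝ (Fin n)).inter_left hX)
  have hBX : convexHull ℝ B ⊆ coneGen X :=
    convexHull_min (Set.inter_subset_left.trans (subset_coneGen X)) (convex_coneGen X)
  have hBs : convexHull ℝ B ⊆ stdSimplex ℝ (Fin n) :=
    convexHull_min Set.inter_subset_right (convex_stdSimplex ℝ (Fin n))
  have hsingle : ∀ x ∈ X, x = 0 ∨ ∃ z ∈ convexHull ℝ B, x = (∑ i, x i) • z := by
    intro x hx
    rcases (Finset.sum_nonneg fun i _ => hnn x hx i).eq_or_lt with h | h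
    · left
      ext i
      exact (Finset.sum_eq_zero_iff_of_nonneg fun i _ => hnn x hx i).1 h.symm i (Finset.mem_univ i)
    · right
      refine ⟨(∑ i, x i)⁻¹ • x, subset_convexHull ℝ B ⟨hsmul _ (by positivity) x hx,
        fun i => mul_nonneg (by positivity) (hnn x hx i), ?_⟩, ?_⟩
      · simp [← Finset.mul_sum, h.ne']
      · rw [smul_smul, mul_inv_cancel₀ h.ne', one_smul]
  have hrep : ∀ v ∈ coneGen X, v = 0 ∨ ∃ r : ℝ, 0 ≤ r ∧ ∃ z ∈ convexHull ℝ B, v = r • z := by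
    rintro _ ⟨k, c, x, hc, hx, rfl⟩
    refine Finset.sum_induction (fun i => c i • x i)
      (fun v => v = 0 ∨ ∃ r : ℝ, 0 ≤ r ∧ ∃ z ∈ convexHull ℝ B, v = r • z) ?_ (Or.inl rfl) ?_
    · rintro u v (rfl | ⟨r, hr, z, hz, rfl⟩) (rfl | ⟨s, hs, w, hw, rfl⟩)
      · simp
      · exact Or.inr ⟨s, hs, w, hw, by simp⟩
      · exact Or.inr ⟨r, hr, z, hz, by simp⟩
      · have hmem : r • z + s • w ∈ (r + s) • convexHull ℝ B := by
          rw [(convex_convexHull ℝ B).add_smul hr hs]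
          exact Set.add_mem_add (Set.smul_mem_smul_set hz) (Set.smul_mem_smul_set hw)
        obtain ⟨y, hy, hyeq⟩ := hmem
        exact Or.inr ⟨r + s, add_nonneg hr hs, y, hy, hyeq.symm⟩
    · intro i _
      rcases hsingle _ (hx i) with h | ⟨z, hz, h⟩
      · left; simp [h]
      · right
        refine ⟨c i * ∑ j, x i j, mul_nonneg (hc i) (Finset.sum_nonneg fun j _ => hnn _ (hx i) j),
          z, hz, ?_⟩
        rw [mul_smul, ← h]
  have hsum : ∀ v ∈ coneGen X, v = 0 ∨ ∃ z ∈ convexHull ℝ B, v = (∑ i, v i) • z := by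
    intro v hv
    rcases hrep v hv with h | ⟨r, _, z, hz, rfl⟩
    · exact Or.inl h
    · refine Or.inr ⟨z, hz, ?_⟩
      congr 1
      simp [← Finset.mul_sum, (hBs hz).2]
  refine IsSeqClosed.isClosed fun u v hu huv => ?_
  by_cases h0 : v = 0
  · rw [h0]; exact zero_mem_coneGen X
  have hev : ∀ᶠ k in Filter.atTop, ∃ z ∈ convexHull ℝ B, u k = (∑ i, u k i) • z := by
    filter_upwards [huv.eventually_ne h0] with k hk
    exact (hsum _ (hu k)).resolve_left hk
  obtain ⟨N, hN⟩ := Filter.eventually_atTop.1 hev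
  choose z hz hzu using fun k => hN (k + N) (Nat.le_add_left N k)
  obtain ⟨a, ha, φ, hφ, hlim⟩ := hBc.tendsto_subseq hz
  have hu' : Filter.Tendsto (fun k => u (φ k + N)) Filter.atTop (nhds v) :=
    (huv.comp (Filter.tendsto_add_atTop_nat N)).comp hφ.tendsto_atTop
  have hs : Filter.Tendsto (fun k => ∑ i, u (φ k + N) i) Filter.atTop (nhds (∑ i, v i)) :=
    ((by fun_prop : Continuous fun v : Fin n → ℝ => ∑ i, v i).tendsto v).comp hu'
  have heq : v = (∑ i, v i) • a := by
    refine tendsto_nhds_unique hu' ((hs.smul hlim).congr fun k => ?_)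
    exact (hzu (φ k)).symm
  rw [heq]
  exact coneGen_smul_mem (ge_of_tendsto' hs fun k =>
    Finset.sum_nonneg fun i _ => coneGen_nonneg hnn (hu _) i) (hBX ha)

/-- A closed homogeneous spanning set of nonnegative vectors generates a proper cone. -/
theorem isProperCone_coneGen {n : ℕ} {X : Set (Fin n → ℝ)} (hX : IsClosed X)
    (hsmul : ∀ r : ℝ, 0 ≤ r → ∀ x ∈ X, r • x ∈ X) (hnn : ∀ x ∈ X, ∀ i, 0 ≤ x i)
    (hspan : Submodule.span ℝ X = ⊤) : IsProperCone (coneGen X) := by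
  refine ⟨zero_mem_coneGen X, fun x hx y hy => coneGen_add_mem hx hy,
    fun r hr x hx => coneGen_smul_mem hr hx, isClosed_coneGen hX hsmul hnn, ?_, ?_⟩
  · intro x hx hx'
    ext i
    have h1 := coneGen_nonneg hnn hx i
    have h2 := coneGen_nonneg hnn hx' i
    simp only [Pi.neg_apply] at h2
    simp only [Pi.zero_apply]
    linarith
  · rw [(convex_coneGen X).interior_nonempty_iff_affineSpan_eq_top,
      ← Set.insert_eq_of_mem (zero_mem_coneGen X)]
    have h : Submodule.span ℝ (coneGen X) = ⊤ :=
      top_unique (hspan ▸ Submodule.span_mono (subset_coneGen X))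
    apply SetLike.coe_injective
    rw [affineSpan_insert_zero, h]
    rfl

theorem coneGen_map_mem {n : ℕ} {X : Set (Fin n → ℝ)} (L : (Fin n → ℝ) →ₗ[ℝ] (Fin n → ℝ))
    (hL : ∀ x ∈ X, L x ∈ X) {v : Fin n → ℝ} (hv : v ∈ coneGen X) : L v ∈ coneGen X := by
  obtain ⟨k, c, x, hc, hx, rfl⟩ := hv
  exact ⟨k, c, fun i => L (x i), hc, fun i => hL _ (hx i), by simp⟩

/-- A complex matrix all of whose pairings with two separating sets of real vectors are real has
real entries. -/
theorem im_eq_zero_of_dotProduct_mulVec {n : ℕ} {X Y : Set (Fin n → ℝ)}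
    (hX : ∀ w : Fin n → ℝ, w ≠ 0 → ∃ x ∈ X, w ⬝ᵥ x ≠ 0)
    (hY : ∀ w : Fin n → ℝ, w ≠ 0 → ∃ y ∈ Y, y ⬝ᵥ w ≠ 0) {A : Matrix (Fin n) (Fin n) ℂ}
    (hA : ∀ x ∈ X, ∀ y ∈ Y,
      ((fun i => (y i : ℂ)) ⬝ᵥ A *ᵥ (fun i => (x i : ℂ))).im = 0) (i j : Fin n) :
    (A i j).im = 0 := by
  have h1 : ∀ x ∈ X, A.map Complex.im *ᵥ x = 0 := by
    intro x hx
    by_contra h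
    obtain ⟨y, hy, hne⟩ := hY _ h
    apply hne
    simpa [dotProduct, mulVec] using hA x hx y hy
  have h2 : (A.map Complex.im).row i = 0 := by
    by_contra h
    obtain ⟨x, hx, hne⟩ := hX _ h
    exact hne (congrFun (h1 x hx) i)
  exact congrFun h2 j

theorem DiagSimNonneg.diag_nonneg {n : ℕ} {A : Matrix (Fin n) (Fin n) ℂ} (hA : DiagSimNonneg A)
    (i : Fin n) : 0 ≤ A i i := by
  obtain ⟨d, hd, h⟩ := hA
  have hii : (diagonal d * A * diagonal fun i => (d i)⁻¹) i i = A i i := by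
    rw [mul_diagonal, diagonal_mul]
    field_simp [hd i]
  have := h i i
  rw [hii] at this
  exact Complex.nonneg_iff.2 ⟨this.1, this.2.symm⟩

/-- Two separating sets of vectors with nonnegative coordinatewise products become nonnegative
after scaling the coordinates. -/
theorem exists_scaling_nonneg {n : ℕ} {P Q : Set (Fin n → ℂ)}
    (hP : ∀ w, w ≠ 0 → ∃ x ∈ P, w ⬝ᵥ x ≠ 0) (hQ : ∀ w, w ≠ 0 → ∃ y ∈ Q, y ⬝ᵥ w ≠ 0)
    (hPQ : ∀ x ∈ P, ∀ y ∈ Q, ∀ i, 0 ≤ y i * x i) :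
    ∃ d : Fin n → ℂ, (∀ i, d i ≠ 0) ∧ (∀ x ∈ P, ∀ i, 0 ≤ d i * x i) ∧
      ∀ y ∈ Q, ∀ i, 0 ≤ y i * (d i)⁻¹ := by
  have hQ' : ∀ i, ∃ y ∈ Q, y i ≠ 0 := fun i => by
    simpa using hQ (Pi.single i 1) (by simp)
  choose y hy hyne using hQ'
  refine ⟨fun i => y i i, hyne, fun x hx i => hPQ x hx _ (hy i) i, fun z hz i => ?_⟩
  obtain ⟨x, hx, hxne⟩ : ∃ x ∈ P, x i ≠ 0 := by
    simpa using hP (Pi.single i 1) (by simp)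
  have h := mul_nonneg (hPQ x hx z hz i) (inv_nonneg.2 (hPQ x hx _ (hy i) i))
  have heq : z i * x i * (y i i * x i)⁻¹ = z i * (y i i)⁻¹ := by field_simp
  rwa [heq] at h

end

/-- An irreducible, homogenization-closed and topologically closed semigroup
`S ⊆ M_n(ℂ)` whose members are each diagonally similar to nonnegative matrices is, after a
single diagonal similarity, real; its ideal of rank-≤-1 members has the form `X Yᵀ` with
`X, Y ⊆ ℝ₊ⁿ` spanning `ℂⁿ`, and the cone generated by `X` is a proper cone invariant under
every member. -/
theorem stmt_6 {n : ℕ} (hn : 2 ≤ n) (S : Set (Matrix (Fin n) (Fin n) ℂ))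
    (hsemi : ∀ A ∈ S, ∀ B ∈ S, A * B ∈ S)
    (hirr : ∀ p : Submodule ℂ (Fin n → ℂ),
      (∀ A ∈ S, ∀ v ∈ p, A.mulVec v ∈ p) → p = ⊥ ∨ p = ⊤)
    (hclos : closure {M | ∃ r : ℝ, 0 ≤ r ∧ ∃ A ∈ S, M = (r : ℂ) • A} = S)
    (hdiagsim : ∀ A ∈ S, DiagSimNonneg A) :
    ∃ d : Fin n → ℂ, (∀ i, d i ≠ 0) ∧
      (∀ A ∈ S, ∀ i j, ((diagonal d * A * diagonal (fun i => (d i)⁻¹)) i j).im = 0) ∧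
      ∃ X Y : Set (Fin n → ℝ),
        (∀ x ∈ X, ∀ i, 0 ≤ x i) ∧ (∀ y ∈ Y, ∀ i, 0 ≤ y i) ∧
        Submodule.span ℂ ((fun x : Fin n → ℝ => fun i => (x i : ℂ)) '' X) = ⊤ ∧
        Submodule.span ℂ ((fun y : Fin n → ℝ => fun i => (y i : ℂ)) '' Y) = ⊤ ∧
        ((fun A => diagonal d * A * diagonal (fun i => (d i)⁻¹)) ''
          {A ∈ S | A.rank ≤ 1} =
          {M | ∃ x ∈ X, ∃ y ∈ Y,
            M = vecMulVec (fun i => (x i : ℂ)) (fun i => (y i : ℂ))}) ∧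
        IsProperCone (coneGen X) ∧
        (∀ A ∈ S, ∀ v ∈ coneGen X,
          (fun i => ((diagonal d * A * diagonal (fun i => (d i)⁻¹)).mulVec
            (fun j => (v j : ℂ)) i).re) ∈ coneGen X) := by
  have hclosed : IsClosed S := hclos ▸ isClosed_closure
  have hsmul : ∀ r : ℝ, 0 ≤ r → ∀ A ∈ S, (r : ℂ) • A ∈ S := fun r hr A hA =>
    hclos ▸ subset_closure ⟨r, hr, A, hA, rfl⟩
  have hsep : ∀ v w : Fin n → ℂ, v ≠ 0 → w ≠ 0 → ∃ B ∈ S, w ⬝ᵥ B *ᵥ v ≠ 0 := fun v w hv hw =>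
    exists_dotProduct_mulVec_ne_zero hn hsemi hirr hv hw
  have hdiag := fun A hA i => (hdiagsim A hA).diag_nonneg i
  have : NeZero n := ⟨by omega⟩
  obtain ⟨u, v, huv, hpos⟩ := exists_vecMulVec_mem hsemi hclosed hsmul hsep hdiag
  obtain ⟨P, Q, hPclosed, hPinv, hPsmul, hPsep, hQsep, hPQ, hpair, hrank⟩ :=
    exists_rank_le_one_eq_vecMulVec hsemi hclosed hsmul hsep hdiag huv hpos
  obtain ⟨d, hd, hdP, hdQ⟩ := exists_scaling_nonneg hPsep hQsep hPQ
  let X : Set (Fin n → ℝ) := {x | (fun i => (d i)⁻¹ * (x i : ℂ)) ∈ P}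
  let Y : Set (Fin n → ℝ) := {y | (fun i => (y i : ℂ) * d i) ∈ Q}
  have hXP : ∀ x ∈ P, ∃ x' ∈ X, ∀ i, (x' i : ℂ) = d i * x i := by
    intro x hx
    have h : ∀ i, ((d i * x i).re : ℂ) = d i * x i := fun i =>
      Complex.ext rfl (Complex.nonneg_iff.1 (hdP x hx i)).2
    refine ⟨fun i => (d i * x i).re, ?_, h⟩
    change (fun i => (d i)⁻¹ * ((d i * x i).re : ℂ)) ∈ P
    convert hx using 2 with i
    rw [h, inv_mul_cancel_left₀ (hd i)]
  have hYQ : ∀ y ∈ Q, ∃ y' ∈ Y, ∀ i, (y' i : ℂ) = y i * (d i)⁻¹ := by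
    intro y hy
    have h : ∀ i, ((y i * (d i)⁻¹).re : ℂ) = y i * (d i)⁻¹ := fun i =>
      Complex.ext rfl (Complex.nonneg_iff.1 (hdQ y hy i)).2
    refine ⟨fun i => (y i * (d i)⁻¹).re, ?_, h⟩
    change (fun i => ((y i * (d i)⁻¹).re : ℂ) * d i) ∈ Q
    convert hy using 2 with i
    rw [h, inv_mul_cancel_right₀ (hd i)]
  have hXnn : ∀ x ∈ X, ∀ i, 0 ≤ x i := by
    intro x hx i
    have h := (Complex.nonneg_iff.1 (hdP _ hx i)).1
    rwa [mul_inv_cancel_left₀ (hd i)] at h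
  have hYnn : ∀ y ∈ Y, ∀ i, 0 ≤ y i := by
    intro y hy i
    have h := (Complex.nonneg_iff.1 (hdQ _ hy i)).1
    rwa [mul_inv_cancel_right₀ (hd i)] at h
  have hXsep : ∀ w : Fin n → ℂ, w ≠ 0 → ∃ x ∈ X, w ⬝ᵥ (fun i => (x i : ℂ)) ≠ 0 := by
    intro w hw
    obtain ⟨x, hx, hne⟩ := hPsep (fun i => w i * d i) (by
      intro h
      exact hw (funext fun i => by simpa [hd i] using congrFun h i))
    obtain ⟨x', hx', heq⟩ := hXP x hx
    refine ⟨x', hx', ?_⟩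
    simpa only [dotProduct, heq, mul_assoc] using hne
  have hYsep : ∀ w : Fin n → ℂ, w ≠ 0 → ∃ y ∈ Y, (fun i => (y i : ℂ)) ⬝ᵥ w ≠ 0 := by
    intro w hw
    obtain ⟨y, hy, hne⟩ := hQsep (fun i => (d i)⁻¹ * w i) (by
      intro h
      exact hw (funext fun i => by simpa [hd i] using congrFun h i))
    obtain ⟨y', hy', heq⟩ := hYQ y hy
    refine ⟨y', hy', ?_⟩
    simpa only [dotProduct, heq, mul_assoc] using hne
  have hofReal : ∀ w : Fin n → ℝ, w ≠ 0 → (fun i => (w i : ℂ)) ≠ 0 := fun w hw h =>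
    hw (funext fun i => by simpa using congrFun h i)
  have hXsepR : ∀ w : Fin n → ℝ, w ≠ 0 → ∃ x ∈ X, w ⬝ᵥ x ≠ 0 := by
    intro w hw
    obtain ⟨x, hx, hne⟩ := hXsep _ (hofReal w hw)
    exact ⟨x, hx, fun h => hne (by simpa [dotProduct] using congrArg Complex.ofReal h)⟩
  have hYsepR : ∀ w : Fin n → ℝ, w ≠ 0 → ∃ y ∈ Y, y ⬝ᵥ w ≠ 0 := by
    intro w hw
    obtain ⟨y, hy, hne⟩ := hYsep _ (hofReal w hw)
    exact ⟨y, hy, fun h => hne (by simpa [dotProduct] using congrArg Complex.ofReal h)⟩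
  have hentry : ∀ (A : Matrix (Fin n) (Fin n) ℂ) i j,
      (diagonal d * A * diagonal fun i => (d i)⁻¹) i j = d i * A i j * (d j)⁻¹ := by
    intro A i j
    rw [mul_diagonal, diagonal_mul]
  have hconj : ∀ (A : Matrix (Fin n) (Fin n) ℂ) (x : Fin n → ℝ) i,
      ((diagonal d * A * diagonal fun i => (d i)⁻¹) *ᵥ fun j => (x j : ℂ)) i =
        d i * (A *ᵥ fun j => (d j)⁻¹ * (x j : ℂ)) i := by
    intro A x i
    simp only [mulVec, dotProduct, hentry, Finset.mul_sum, mul_assoc]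
  have hreal : ∀ A ∈ S, ∀ i j,
      ((diagonal d * A * diagonal fun i => (d i)⁻¹) i j).im = 0 := by
    intro A hA
    refine im_eq_zero_of_dotProduct_mulVec hXsepR hYsepR fun x hx y hy => ?_
    have h := (Complex.nonneg_iff.1 (hpair A hA _ hx _ hy)).2
    simp only [dotProduct, hconj]
    simpa only [dotProduct, mul_assoc] using h.symm
  refine ⟨d, hd, hreal, X, Y, hXnn, hYnn, ?_, ?_, ?_, ?_, ?_⟩
  · refine span_eq_top_of_dotProduct_ne_zero fun w hw => ?_
    obtain ⟨x, hx, hne⟩ := hXsep w hw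
    exact ⟨_, ⟨x, hx, rfl⟩, hne⟩
  · refine span_eq_top_of_dotProduct_ne_zero fun w hw => ?_
    obtain ⟨y, hy, hne⟩ := hYsep w hw
    exact ⟨_, ⟨y, hy, rfl⟩, by rwa [dotProduct_comm]⟩
  · ext M
    constructor
    · rintro ⟨A, hA, rfl⟩
      obtain ⟨x, hx, y, hy, rfl⟩ := (hrank A).1 hA
      obtain ⟨x', hx', hxeq⟩ := hXP x hx
      obtain ⟨y', hy', hyeq⟩ := hYQ y hy
      refine ⟨x', hx', y', hy', ?_⟩
      ext i j
      simp only [hentry, vecMulVec_apply, hxeq, hyeq, mul_assoc]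
    · rintro ⟨x, hx, y, hy, rfl⟩
      refine ⟨_, (hrank _).2 ⟨_, hx, _, hy, rfl⟩, ?_⟩
      ext i j
      simp only [hentry, vecMulVec_apply]
      rw [← mul_assoc, mul_inv_cancel_left₀ (hd i), mul_assoc, mul_inv_cancel_right₀ (hd j)]
  · refine isProperCone_coneGen (hPclosed.preimage (by fun_prop)) (fun r hr x hx => ?_) hXnn
      (span_eq_top_of_dotProduct_ne_zero hXsepR)
    change (fun i => (d i)⁻¹ * ((r • x) i : ℂ)) ∈ P
    convert hPsmul r hr _ hx using 2 with i
    simp [mul_left_comm]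
  · intro A hA v hv
    have hL : ∀ w : Fin n → ℝ,
        (fun i => ((diagonal d * A * diagonal fun i => (d i)⁻¹) *ᵥ fun j => (w j : ℂ)) i |>.re) =
          (diagonal d * A * diagonal fun i => (d i)⁻¹).map Complex.re *ᵥ w := by
      intro w
      ext i
      simp [mulVec, dotProduct, -diagonal_mul, -mul_diagonal]
    rw [hL]
    refine coneGen_map_mem (Matrix.mulVecLin _) (fun x hx => ?_) hv
    rw [Matrix.mulVecLin_apply, ← hL]
    obtain ⟨x', hx', heq⟩ := hXP _ (hPinv A hA _ hx)
    convert hx'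
    rw [hconj, ← heq, Complex.ofReal_re]
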